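/- Let g ∈ S₀(ℝ), let α, β > 0 be such that (g, αℤ×βℤ) is a frame sequence with closed linear span 𝒢 = 𝒢(g, αℤ×βℤ) and canonical dual window γ, and let ν ∈ ℕ, ν ≥ 1. If ⟨T_{k/β} M_{ℓ/α} γ, g⟩ = 0 for all k ∈ ℤ and all ℓ ∈ ℤ with ℓ ∉ νℤ, then T_{α/ν} g ∈ 𝒢. -/

import Mathlib

open MeasureTheory Complex Filter
open scoped ENNReal InnerProductSpace RealInnerProductSpace ComplexConjugate

noncomputable section

/-- The Hilbert space `L²(ℝ)` of complex-valued square-integrable functions. -/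
abbrev L2 : Type := Lp ℂ 2 (volume : Measure ℝ)

lemma memLp_translate (a : ℝ) (f : L2) :
    MemLp (fun x : ℝ => f (x - a)) 2 (volume : Measure ℝ) :=
  (Lp.memLp f).comp_measurePreserving (measurePreserving_sub_right volume a)

lemma memLp_modulate (b : ℝ) (f : L2) :
    MemLp (fun x : ℝ => Complex.exp (2 * Real.pi * Complex.I * (b * x)) * f x) 2
      (volume : Measure ℝ) := by
  refine MemLp.of_le (Lp.memLp f) ?_ ?_
  · exact (Complex.continuous_exp.comp (by fun_prop)).aestronglyMeasurable.mul
      (Lp.aestronglyMeasurable f)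
  · filter_upwards with x
    have : Complex.exp (2 * Real.pi * Complex.I * (b * x))
        = Complex.exp ((2 * Real.pi * (b * x) : ℝ) * Complex.I) := by
      push_cast; ring_nf
    rw [norm_mul, this, Complex.norm_exp_ofReal_mul_I, one_mul]

/-- Translation `T_a` on `L²(ℝ)`: `(T_a f)(x) = f (x - a)`. -/
def Tr (a : ℝ) (f : L2) : L2 := (memLp_translate a f).toLp _

/-- Modulation `M_b` on `L²(ℝ)`: `(M_b f)(x) = e^{2πibx} f x`. -/
def Mo (b : ℝ) (f : L2) : L2 := (memLp_modulate b f).toLp _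

/-- Time-frequency shift `π(a,b) = T_a M_b`. -/
def tf (z : ℝ × ℝ) (f : L2) : L2 := Tr z.1 (Mo z.2 f)

/-- The closed linear span `𝒢(g,Λ)` of the Gabor system `(g,Λ)`. -/
def gaborSpan (g : L2) (Λ : Set (ℝ × ℝ)) : Set L2 :=
  closure (Submodule.span ℂ ((fun z => tf z g) '' Λ) : Set L2)

/-- `𝔍(𝒢)`: the set of time-frequency shifts leaving `𝒢` invariant. -/
def stab (G : Set L2) : Set (ℝ × ℝ) := {z | ∀ f ∈ G, tf z f ∈ G}

/-- `Λ` is a lattice in `ℝ²` if `Λ = Aℤ²` for an invertible `2×2` matrix `A`. -/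
def IsLattice (Λ : Set (ℝ × ℝ)) : Prop :=
  ∃ A : Matrix (Fin 2) (Fin 2) ℝ, IsUnit A.det ∧
    Λ = {p : ℝ × ℝ | ∃ k l : ℤ,
      p = (A 0 0 * k + A 0 1 * l, A 1 0 * k + A 1 1 * l)}

lemma memLp_gaussian : MemLp (fun x : ℝ => (Real.exp (-Real.pi * x ^ 2) : ℂ)) 2
    (volume : Measure ℝ) := by
  rw [memLp_two_iff_integrable_sq_norm]
  · have h : Integrable (fun x : ℝ => Real.exp (-(2 * Real.pi) * x ^ 2)) volume :=
      integrable_exp_neg_mul_sq (by positivity)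
    refine h.congr (Eventually.of_forall fun x => ?_)
    simp only [Complex.norm_real, Real.norm_eq_abs, Real.abs_exp, sq, ← Real.exp_add]
    ring_nf
  · exact (Complex.continuous_ofReal.comp (by fun_prop)).aestronglyMeasurable

/-- The Gaussian `φ(x) = e^{-πx²}` as an element of `L²(ℝ)`. -/
def gaussL2 : L2 := memLp_gaussian.toLp _

/-- The Feichtinger algebra condition: `f ∈ S₀(ℝ)` iff `(a,b) ↦ ⟨f, π(a,b)φ⟩ ∈ L¹(ℝ²)`. -/
def InS0 (f : L2) : Prop :=
  Integrable (fun z : ℝ × ℝ => ⟪tf z gaussL2, f⟫_ℂ) (volume : Measure (ℝ × ℝ))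

/-- `(g,Λ)` is a frame for its closed linear span. -/
def IsFrameSeq (g : L2) (Λ : Set (ℝ × ℝ)) : Prop :=
  ∃ A B : ℝ, 0 < A ∧ 0 < B ∧ ∀ f ∈ gaborSpan g Λ,
    A * ‖f‖ ^ 2 ≤ ∑' lam : Λ, ‖⟪tf (lam : ℝ × ℝ) g, f⟫_ℂ‖ ^ 2 ∧
    ∑' lam : Λ, ‖⟪tf (lam : ℝ × ℝ) g, f⟫_ℂ‖ ^ 2 ≤ B * ‖f‖ ^ 2

/-- `(g,Λ)` is a frame for all of `L²(ℝ)`. -/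
def IsFrameL2 (g : L2) (Λ : Set (ℝ × ℝ)) : Prop :=
  ∃ A B : ℝ, 0 < A ∧ 0 < B ∧ ∀ f : L2,
    A * ‖f‖ ^ 2 ≤ ∑' lam : Λ, ‖⟪tf (lam : ℝ × ℝ) g, f⟫_ℂ‖ ^ 2 ∧
    ∑' lam : Λ, ‖⟪tf (lam : ℝ × ℝ) g, f⟫_ℂ‖ ^ 2 ≤ B * ‖f‖ ^ 2

/-- Euclidean ball of radius `ε` around `a ∈ ℝ²`. -/
def eball (ε : ℝ) (a : ℝ × ℝ) : Set (ℝ × ℝ) :=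
  {x : ℝ × ℝ | Real.sqrt ((x.1 - a.1) ^ 2 + (x.2 - a.2) ^ 2) < ε}

/-- `B_ε(Δ) = ⋃_{a ∈ Δ} B_ε(a)`. -/
def eballSet (ε : ℝ) (Δ : Set (ℝ × ℝ)) : Set (ℝ × ℝ) := ⋃ a ∈ Δ, eball ε a

/-- The separable lattice `αℤ × βℤ`. -/
def sepLattice (α β : ℝ) : Set (ℝ × ℝ) :=
  {p : ℝ × ℝ | ∃ k l : ℤ, p = (α * k, β * l)}


/-- `γ` is the canonical dual window of the frame sequence `(g, αℤ×βℤ)`: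
`γ` belongs to `𝒢(g, αℤ×βℤ)` and `Sγ = g` for the frame operator `S`,
the defining series converging unconditionally in `L²`. -/
def IsDualWindow (g γ : L2) (α β : ℝ) : Prop :=
  γ ∈ gaborSpan g (sepLattice α β) ∧
  HasSum (fun lam : sepLattice α β =>
    ⟪tf (lam : ℝ × ℝ) g, γ⟫_ℂ • tf (lam : ℝ × ℝ) g) g

/-- Dual reconstruction for a frame sequence `e` with closed span `K`: a family `d` in `K` that the
frame operator maps onto `e` represents the orthogonal projection onto `K`. -/
lemma hasSum_inner_mul_inner_starProjection {ι H : Type*} [NormedAddCommGroup H]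
    [InnerProductSpace ℂ H] [CompleteSpace H] (e d : ι → H) (K : Submodule ℂ H)
    [CompleteSpace K] (heK : ∀ i, e i ∈ K) (hdK : ∀ i, d i ∈ K)
    {A B : ℝ} (hA : 0 < A)
    (hlow : ∀ f ∈ K, A * ‖f‖ ^ 2 ≤ ∑' i, ‖⟪e i, f⟫_ℂ‖ ^ 2)
    (hup : ∀ f ∈ K, ∑' i, ‖⟪e i, f⟫_ℂ‖ ^ 2 ≤ B * ‖f‖ ^ 2)
    (hd : ∀ i, HasSum (fun j => ⟪e j, d i⟫_ℂ • e j) (e i)) (f h : H) :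
    HasSum (fun i => ⟪h, e i⟫_ℂ * ⟪d i, f⟫_ℂ) ⟪h, K.starProjection f⟫_ℂ := by
  have hsum : ∀ x : K, Summable fun i => ‖⟪e i, (x : H)⟫_ℂ‖ ^ 2 := by
    intro x
    by_contra hns
    have h0 := hlow x x.2
    rw [tsum_eq_zero_of_not_summable hns] at h0
    have hx : (x : H) = 0 := by
      have : ‖(x : H)‖ ^ 2 ≤ 0 := by
        by_contra hlt
        push Not at hlt
        nlinarith
      simpa using this
    exact hns (by simp [hx])
  have hmem : ∀ x : K, Memℓp (fun i => ⟪e i, (x : H)⟫_ℂ) 2 := by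
    intro x
    refine memℓp_gen ?_
    simpa using hsum x
  let C₀ : K →ₗ[ℂ] lp (fun _ : ι => ℂ) 2 :=
    { toFun := fun x => ⟨fun i => ⟪e i, (x : H)⟫_ℂ, hmem x⟩
      map_add' := by
        intro x y; ext i; exact inner_add_right _ _ _
      map_smul' := by
        intro c x; ext i; exact inner_smul_right _ _ _ }
  have hC₀ : ∀ x : K, ‖C₀ x‖ ^ 2 = ∑' i, ‖⟪e i, (x : H)⟫_ℂ‖ ^ 2 := by
    intro x
    have := lp.norm_rpow_eq_tsum (p := 2) (by norm_num) (C₀ x)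
    simpa [C₀] using this
  let C : K →L[ℂ] lp (fun _ : ι => ℂ) 2 := C₀.mkContinuous (Real.sqrt B) (by
    intro x
    rw [← Real.sqrt_sq (norm_nonneg (C₀ x)), hC₀]
    refine (Real.sqrt_le_sqrt (hup x x.2)).trans ?_
    rw [Real.sqrt_mul' _ (by positivity), Real.sqrt_sq (norm_nonneg _)]
    rfl)
  have hCapp : ∀ (x : K) i, C x i = ⟪e i, (x : H)⟫_ℂ := fun x i => rfl
  let S : K →L[ℂ] K := C.adjoint ∘L C
  have hS : ∀ x y : K, HasSum (fun i => ⟪(x : H), e i⟫_ℂ * ⟪e i, (y : H)⟫_ℂ) ⟪x, S y⟫_ℂ := by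
    intro x y
    have h1 := lp.hasSum_inner (𝕜 := ℂ) (C x) (C y)
    have h2 : ⟪x, S y⟫_ℂ = ⟪C x, C y⟫_ℂ := by
      simp [S, ContinuousLinearMap.adjoint_inner_right]
    rw [h2]
    refine h1.congr_fun fun i => ?_
    rw [hCapp, hCapp, RCLike.inner_apply, inner_conj_symm, mul_comm]
  have hunit : IsUnit S := by
    refine S.isUnit_of_forall_le_norm_inner_map (c := ⟨A, hA.le⟩) hA fun x => ?_
    have h2 : ⟪S x, x⟫_ℂ = ⟪C x, C x⟫_ℂ := by
      simp [S, ContinuousLinearMap.adjoint_inner_left]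
    rw [h2, inner_self_eq_norm_sq_to_K]
    have h3 : ‖C x‖ ^ 2 = ∑' i, ‖⟪e i, (x : H)⟫_ℂ‖ ^ 2 := hC₀ x
    have h4 := hlow x x.2
    rw [← h3] at h4
    simp only [norm_pow, RCLike.norm_ofReal, abs_norm]
    rw [mul_comm]
    exact h4
  obtain ⟨u, hu⟩ : ∃ u : K, S u = K.orthogonalProjectionOnto f := by
    obtain ⟨U, hU⟩ := hunit
    refine ⟨(↑U⁻¹ : K →L[ℂ] K) (K.orthogonalProjectionOnto f), ?_⟩
    rw [← hU, ← mul_apply_eq_comp, Units.mul_inv, one_apply_eq_self]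
  have hproj : ∀ x ∈ K, ∀ y : H, ⟪x, y⟫_ℂ = ⟪x, (K.orthogonalProjectionOnto y : H)⟫_ℂ := by
    intro x hx y
    exact (K.inner_orthogonalProjectionOnto_eq_of_mem_left ⟨x, hx⟩ y).symm
  have hdu : ∀ i, ⟪d i, f⟫_ℂ = ⟪e i, (u : H)⟫_ℂ := by
    intro i
    rw [hproj _ (hdK i) f, ← hu]
    refine (hS ⟨d i, hdK i⟩ u).unique ?_
    have h1 := (hd i).mapL ((innerSL ℂ (u : H)))
    have h2 := h1.star
    simp only [innerSL_apply_apply, inner_smul_right, star_mul', RCLike.star_def, inner_conj_symm] at h2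
    exact h2
  have hfin := hS (K.orthogonalProjectionOnto h) u
  rw [hu] at hfin
  have h5 : ⟪h, K.starProjection f⟫_ℂ
      = ⟪K.orthogonalProjectionOnto h, K.orthogonalProjectionOnto f⟫_ℂ := by
    rw [Submodule.starProjection_apply, Submodule.coe_inner]
    exact (K.inner_orthogonalProjectionOnto_eq_of_mem_right (K.orthogonalProjectionOnto f) h).symm
  rw [h5]
  refine hfin.congr_fun fun i => ?_
  rw [hdu, ← inner_conj_symm h, hproj _ (heK i) h, inner_conj_symm]

lemma norm_exp_two_pi_I_mul (c x : ℝ) :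
    ‖Complex.exp (2 * Real.pi * Complex.I * (c * x))‖ = 1 := by
  have : 2 * Real.pi * Complex.I * (c * x) = ((2 * Real.pi * (c * x) : ℝ) * Complex.I) := by
    push_cast; ring_nf
  rw [this, Complex.norm_exp_ofReal_mul_I]

/-- A continuous periodization of an integrable function vanishes if the Fourier transform of that
function vanishes at all integers. -/
lemma eq_zero_of_hasSum_comp_add_int {a F : ℝ → ℂ} (ha : Integrable a) (hF : Continuous F)
    (hs : ∀ x, HasSum (fun n : ℤ => a (x + n)) (F x))
    (h0 : ∀ l : ℤ, ∫ x : ℝ, Complex.exp (2 * Real.pi * Complex.I * (l * x)) * a x = 0)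
    (x : ℝ) : F x = 0 := by
  have hper : Function.Periodic F 1 := by
    intro x
    refine (hs (x + 1)).unique ?_
    have := (Equiv.addLeft (1 : ℤ)).hasSum_iff.mpr (hs x)
    refine this.congr_fun fun n => ?_
    simp [add_assoc]
  let G : C(AddCircle (1 : ℝ), ℂ) :=
    ⟨hper.lift, continuous_coinduced_dom.mpr (by exact hF)⟩
  have hcoef : ∀ l : ℤ, fourierCoeff G l = 0 := by
    intro l
    rw [fourierCoeff_eq_intervalIntegral _ _ 0]
    have hint : Integrable fun x : ℝ =>
        Complex.exp (2 * Real.pi * Complex.I * ((-l : ℤ) * x)) * a x := by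
      refine ha.bdd_mul (c := 1) (Continuous.aestronglyMeasurable (by fun_prop)) ?_
      exact Eventually.of_forall fun x => mod_cast (norm_exp_two_pi_I_mul ((-l : ℤ) : ℝ) x).le
    have hpt : ∀ x : ℝ, HasSum (fun n : ℤ =>
        Complex.exp (2 * Real.pi * Complex.I * ((-l : ℤ) * ((x + n : ℝ) : ℂ))) * a (x + n))
        (fourier (-l) (x : AddCircle (1 : ℝ)) • G x) := by
      intro x
      have h1 := (hs x).mul_left (Complex.exp (2 * Real.pi * Complex.I * ((-l : ℤ) * x)))
      have h2 : fourier (-l) (x : AddCircle (1 : ℝ)) • G x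
          = Complex.exp (2 * Real.pi * Complex.I * ((-l : ℤ) * x)) * F x := by
        rw [fourier_coe_apply, smul_eq_mul]
        congr 1
        push_cast; ring_nf
      rw [h2]
      refine h1.congr_fun fun n => ?_
      congr 1
      refine Complex.exp_eq_exp_iff_exists_int.mpr ⟨-l * n, ?_⟩
      push_cast; ring
    have h3 := hint.hasSum_intervalIntegral_comp_add_int
    rw [h0 (-l)] at h3
    have h4 : HasSum (fun n : ℤ => ∫ x : ℝ in 0..1,
        Complex.exp (2 * Real.pi * Complex.I * ((-l : ℤ) * ((x + n : ℝ) : ℂ))) * a (x + n))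
        (∫ x : ℝ in 0..1, fourier (-l) (x : AddCircle (1 : ℝ)) • G x) := by
      simp only [intervalIntegral.integral_of_le zero_le_one]
      have h5 := hasSum_integral_of_summable_integral_norm
        (μ := volume.restrict (Set.Ioc (0 : ℝ) 1)) (F := fun (n : ℤ) (x : ℝ) =>
        Complex.exp (2 * Real.pi * Complex.I * ((-l : ℤ) * ((x + n : ℝ) : ℂ))) * a (x + n))
        (fun n => (hint.comp_add_right (n : ℝ)).integrableOn) (by
          have := hint.norm.hasSum_intervalIntegral_comp_add_int.summable
          simpa only [intervalIntegral.integral_of_le zero_le_one] using this)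
      simpa only [(hpt _).tsum_eq] using h5
    rw [zero_add, h4.unique h3, smul_zero]
  have hsum := has_pointwise_sum_fourier_series_of_summable (f := G)
    (by simpa only [funext hcoef] using summable_zero) (x : AddCircle (1 : ℝ))
  simp only [hcoef, zero_smul] at hsum
  exact hsum.unique hasSum_zero

/-- Parseval's identity for Fourier coefficients on an interval of length `T`. -/
lemma hasSum_setIntegral_mul_setIntegral {T : ℝ} (hT : 0 < T) (t : ℝ) {φ ψ : ℝ → ℂ}
    (hφ : MemLp φ 2 (volume.restrict (Set.Ioc t (t + T))))
    (hψ : MemLp ψ 2 (volume.restrict (Set.Ioc t (t + T)))) :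
    HasSum (fun m : ℤ =>
      (∫ y in Set.Ioc t (t + T), Complex.exp (2 * Real.pi * Complex.I * (m / T * y)) * ψ y) *
      (∫ y in Set.Ioc t (t + T), Complex.exp (-(2 * Real.pi * Complex.I * (m / T * y))) * φ y))
      (T * ∫ y in Set.Ioc t (t + T), ψ y * φ y) := by
  have : Fact (0 < T) := ⟨hT⟩
  have hTc : (T : ℂ) ≠ 0 := by exact_mod_cast hT.ne'
  have hψ' : MemLp (fun y => conj (ψ y)) 2 (volume.restrict (Set.Ioc t (t + T))) := hψ.star
  have hcoef : ∀ {χ : ℝ → ℂ} (hχ : MemLp χ 2 (volume.restrict (Set.Ioc t (t + T)))) (m : ℤ),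
      ⟪fourierBasis m, hχ.memLp_liftIoc.haarAddCircle.toLp⟫_ℂ
        = (1 / T : ℂ) * ∫ y in Set.Ioc t (t + T),
          Complex.exp (-(2 * Real.pi * Complex.I * (m / T * y))) * χ y := by
    intro χ hχ m
    rw [← HilbertBasis.repr_apply_apply, fourierBasis_repr,
      fourierCoeff_congr_ae hχ.memLp_liftIoc.haarAddCircle.coeFn_toLp, fourierCoeff_liftIoc_eq,
      fourierCoeffOn_eq_integral, intervalIntegral.integral_of_le (by linarith)]
    simp only [add_sub_cancel_left]
    rw [Complex.real_smul]
    push_cast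
    congr 1
    refine integral_congr_ae (Eventually.of_forall fun y => ?_)
    simp only [smul_eq_mul]
    congr 1
    rw [fourier_coe_apply]
    congr 1
    push_cast
    rw [add_sub_cancel_left]
    ring
  have h := (fourierBasis (T := T)).hasSum_inner_mul_inner
    hψ'.memLp_liftIoc.haarAddCircle.toLp hφ.memLp_liftIoc.haarAddCircle.toLp
  have hinner : ⟪hψ'.memLp_liftIoc.haarAddCircle.toLp, hφ.memLp_liftIoc.haarAddCircle.toLp⟫_ℂ
      = (1 / T : ℂ) * ∫ y in Set.Ioc t (t + T), ψ y * φ y := by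
    rw [L2.inner_def]
    have : ∫ z, ⟪(hψ'.memLp_liftIoc.haarAddCircle.toLp : Lp ℂ 2 (@AddCircle.haarAddCircle T _)) z,
        (hφ.memLp_liftIoc.haarAddCircle.toLp : Lp ℂ 2 (@AddCircle.haarAddCircle T _)) z⟫_ℂ
          ∂AddCircle.haarAddCircle
        = ∫ z, AddCircle.liftIoc T t (fun y => ψ y * φ y) z ∂AddCircle.haarAddCircle := by
      refine integral_congr_ae ?_
      filter_upwards [hψ'.memLp_liftIoc.haarAddCircle.coeFn_toLp,
        hφ.memLp_liftIoc.haarAddCircle.coeFn_toLp] with z h1 h2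
      rw [h1, h2, RCLike.inner_apply]
      simp [AddCircle.liftIoc, mul_comm]
    rw [this, AddCircle.integral_haarAddCircle, AddCircle.integral_liftIoc_eq_intervalIntegral,
      intervalIntegral.integral_of_le (by linarith), Complex.real_smul]
    push_cast
    rw [one_div]
  rw [hinner] at h
  have h2 := h.mul_left ((T : ℂ) * T)
  have h3 : ((T : ℂ) * T) * ((1 / T : ℂ) * ∫ y in Set.Ioc t (t + T), ψ y * φ y)
      = T * ∫ y in Set.Ioc t (t + T), ψ y * φ y := by
    field_simp
  rw [h3] at h2
  refine h2.congr_fun fun m => ?_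
  rw [hcoef hφ, ← inner_conj_symm, hcoef hψ']
  have h4 : conj ((1 / T : ℂ) * ∫ y in Set.Ioc t (t + T),
          Complex.exp (-(2 * Real.pi * Complex.I * (m / T * y))) * conj (ψ y))
      = (1 / T : ℂ) * ∫ y in Set.Ioc t (t + T),
          Complex.exp (2 * Real.pi * Complex.I * (m / T * y)) * ψ y := by
    rw [map_mul, ← integral_conj]
    simp [← Complex.exp_conj, Complex.conj_ofNat]
  rw [h4]
  field_simp

/-- Extending the periodization criterion to period `α`: if the Fourier transform of `a` vanishes at
all `l / α` with `ν ∤ l`, then its continuous `α`-periodization is `α / ν`-periodic. -/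
lemma periodic_of_hasSum_comp_add_mul_int {a F : ℝ → ℂ} (ha : Integrable a) (hF : Continuous F)
    {α : ℝ} (hα : 0 < α) {ν : ℕ} (hν : 1 ≤ ν)
    (hs : ∀ x, HasSum (fun n : ℤ => a (x + α * n)) (F x))
    (h0 : ∀ l : ℤ, ¬ ((ν : ℤ) ∣ l) →
      ∫ x : ℝ, Complex.exp (2 * Real.pi * Complex.I * ((l / α : ℝ) * x)) * a x = 0) :
    Function.Periodic F (α / ν) := by
  have hαc : (α : ℂ) ≠ 0 := by exact_mod_cast hα.ne'
  have hνc : (ν : ℂ) ≠ 0 := by exact_mod_cast (by omega : ν ≠ 0)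
  have hcomp : ∀ c : ℝ, Integrable fun x : ℝ => a (α * x + c) := fun c =>
    (ha.comp_add_right c).comp_mul_left' hα.ne'
  have hint : ∀ (c : ℝ) (l : ℤ), Integrable fun x : ℝ =>
      Complex.exp (2 * Real.pi * Complex.I * (l * x)) * a (α * x + c) := by
    intro c l
    refine (hcomp c).bdd_mul (c := 1) (Continuous.aestronglyMeasurable (by fun_prop)) ?_
    exact Eventually.of_forall fun x => mod_cast (norm_exp_two_pi_I_mul l x).le
  have hcoef : ∀ (c : ℝ) (l : ℤ), ∫ x : ℝ,
      Complex.exp (2 * Real.pi * Complex.I * (l * x)) * a (α * x + c)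
      = Complex.exp (-(2 * Real.pi * Complex.I * (l * (c / α)))) * ((α⁻¹ : ℝ) *
        ∫ x : ℝ, Complex.exp (2 * Real.pi * Complex.I * ((l / α : ℝ) * x)) * a x) := by
    intro c l
    have h1 := Measure.integral_comp_mul_left (fun x : ℝ =>
      Complex.exp (2 * Real.pi * Complex.I * ((l / α : ℝ) * ((x + c : ℝ) : ℂ))) * a (x + c)) α
    rw [integral_add_right_eq_self (fun x : ℝ =>
      Complex.exp (2 * Real.pi * Complex.I * ((l / α : ℝ) * x)) * a x) c,
      abs_of_pos (by positivity), Complex.real_smul] at h1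
    rw [← h1, ← integral_const_mul]
    refine integral_congr_ae (Eventually.of_forall fun x => ?_)
    simp only
    refine Eq.trans ?_ (mul_assoc _ _ _)
    rw [← Complex.exp_add]
    congr 2
    push_cast
    field_simp
    ring
  intro x
  have hzero := eq_zero_of_hasSum_comp_add_int
    (a := fun x => a (α * x + α / ν) - a (α * x + 0))
    (F := fun x => F (α * x + α / ν) - F (α * x + 0))
    ((hcomp _).sub (hcomp _)) (by fun_prop) (by
      intro x
      refine ((hs (α * x + α / ν)).sub (hs (α * x + 0))).congr_fun fun n => ?_
      congr 2 <;> ring) (by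
      intro l
      simp only [mul_sub]
      rw [integral_sub (hint _ l) (hint _ l), hcoef, hcoef]
      by_cases hl : (ν : ℤ) ∣ l
      · obtain ⟨q, rfl⟩ := hl
        have : Complex.exp (-(2 * Real.pi * Complex.I *
            (((ν * q : ℤ) : ℂ) * (((α / ν : ℝ) : ℂ) / α)))) = 1 := by
          refine Complex.exp_eq_one_iff.mpr ⟨-q, ?_⟩
          push_cast
          field_simp
        rw [this]
        simp
      · rw [h0 l hl]; simp) (x / α)
  rw [sub_eq_zero, mul_div_cancel₀ _ hα.ne', add_zero] at hzero
  exact hzero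

/-- The cross-correlation of two integrable functions, as a convolution. -/
lemma integrable_integral_mul_comp_sub {w p : ℝ → ℂ} (hw : Integrable w) (hp : Integrable p) :
    Integrable fun x : ℝ => ∫ y, w y * p (y - x) := by
  have h := hw.integrable_convolution (ContinuousLinearMap.mul ℂ ℂ) hp.comp_neg
  refine h.congr (Eventually.of_forall fun x => ?_)
  simp [convolution]

/-- The Fourier transform of a cross-correlation is the product of the Fourier transforms. -/
lemma integral_exp_mul_integral_mul_comp_sub {w p : ℝ → ℂ} (hw : Integrable w)
    (hp : Integrable p) (c : ℝ) :
    ∫ x : ℝ, Complex.exp (2 * Real.pi * Complex.I * (c * x)) * ∫ y, w y * p (y - x)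
      = (∫ y : ℝ, Complex.exp (2 * Real.pi * Complex.I * (c * y)) * w y) *
        ∫ u : ℝ, Complex.exp (-(2 * Real.pi * Complex.I * (c * u))) * p u := by
  have hmod : ∀ {q : ℝ → ℂ}, Integrable q →
      Integrable fun y : ℝ => Complex.exp (2 * Real.pi * Complex.I * (c * y)) * q y := by
    intro q hq
    refine hq.bdd_mul (c := 1) (Continuous.aestronglyMeasurable (by fun_prop)) ?_
    exact Eventually.of_forall fun x => (norm_exp_two_pi_I_mul c x).le
  have h := integral_convolution (μ := volume) (ν := volume) (ContinuousLinearMap.mul ℂ ℂ)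
    (hmod hw) (hmod hp.comp_neg)
  rw [ContinuousLinearMap.mul_apply',
    ← integral_neg_eq_self (fun y : ℝ => Complex.exp (2 * Real.pi * Complex.I * (c * y)) *
      p (-y))] at h
  simp only [neg_neg, Complex.ofReal_neg, mul_neg] at h
  rw [← h]
  refine integral_congr_ae (Eventually.of_forall fun x => ?_)
  simp only [convolution, ContinuousLinearMap.mul_apply']
  rw [← integral_const_mul]
  refine integral_congr_ae (Eventually.of_forall fun y => ?_)
  simp only [neg_sub]
  have : Complex.exp (2 * Real.pi * Complex.I * (c * x))
      = Complex.exp (2 * Real.pi * Complex.I * (c * y)) *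
        Complex.exp (2 * Real.pi * Complex.I * (c * ((x - y : ℝ) : ℂ))) := by
    rw [← Complex.exp_add]
    congr 1
    push_cast
    ring
  rw [this]
  ring

lemma coeFn_Tr (a : ℝ) (f : L2) : Tr a f =ᵐ[volume] fun x => f (x - a) :=
  (memLp_translate a f).coeFn_toLp

lemma coeFn_tf (z : ℝ × ℝ) (f : L2) : tf z f =ᵐ[volume] fun x =>
    Complex.exp (2 * Real.pi * Complex.I * (z.2 * ((x - z.1 : ℝ) : ℂ))) * f (x - z.1) :=
  (coeFn_Tr z.1 (Mo z.2 f)).trans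
    ((measurePreserving_sub_right volume z.1).quasiMeasurePreserving.ae_eq_comp
      (memLp_modulate z.2 f).coeFn_toLp)

lemma norm_tf (z : ℝ × ℝ) (f : L2) : ‖tf z f‖ = ‖f‖ := by
  have hT : ∀ h : L2, ‖Tr z.1 h‖ = ‖h‖ := by
    intro h
    rw [Lp.norm_def, Lp.norm_def]
    congr 1
    rw [eLpNorm_congr_ae (coeFn_Tr z.1 h)]
    exact eLpNorm_comp_measurePreserving (Lp.aestronglyMeasurable h)
      (measurePreserving_sub_right volume z.1)
  rw [tf, hT, Lp.norm_def, Lp.norm_def]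
  congr 1
  refine eLpNorm_congr_norm_ae ?_
  filter_upwards [(memLp_modulate z.2 f).coeFn_toLp] with x hx
  rw [Mo, hx, norm_mul, norm_exp_two_pi_I_mul, one_mul]

/-- The time-frequency shift `π(z)` as a linear isometry of `L²(ℝ)`. -/
def tfIsometry (z : ℝ × ℝ) : L2 →ₗᵢ[ℂ] L2 where
  toFun := tf z
  map_add' f h := by
    refine Lp.ext ?_
    filter_upwards [coeFn_tf z (f + h), coeFn_tf z f, coeFn_tf z h, Lp.coeFn_add (tf z f) (tf z h),
      (measurePreserving_sub_right volume z.1).quasiMeasurePreserving.ae_eq_comp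
        (Lp.coeFn_add f h)] with x h1 h2 h3 h4 h5
    simp only [Function.comp_apply, Pi.add_apply] at h4 h5
    rw [h1, h4, h2, h3, h5, mul_add]
  map_smul' c f := by
    refine Lp.ext ?_
    filter_upwards [coeFn_tf z (c • f), coeFn_tf z f, Lp.coeFn_smul c (tf z f),
      (measurePreserving_sub_right volume z.1).quasiMeasurePreserving.ae_eq_comp
        (Lp.coeFn_smul c f)] with x h1 h2 h4 h5
    simp only [Function.comp_apply, Pi.smul_apply, smul_eq_mul, RingHom.id_apply] at h4 h5 ⊢
    rw [h1, h4, h2, h5]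
    ring
  norm_map' := norm_tf z

@[simp]
lemma tfIsometry_apply (z : ℝ × ℝ) (f : L2) : tfIsometry z f = tf z f := rfl

lemma inner_tf_tf (z : ℝ × ℝ) (f h : L2) : ⟪tf z f, tf z h⟫_ℂ = ⟪f, h⟫_ℂ :=
  (tfIsometry z).inner_map_map f h

/-- Time-frequency shifts compose up to a phase factor. -/
lemma tf_tf (a b a' b' : ℝ) (f : L2) :
    tf (a, b) (tf (a', b') f)
      = Complex.exp (2 * Real.pi * Complex.I * (b * a')) • tf (a + a', b + b') f := by
  refine Lp.ext ?_
  filter_upwards [coeFn_tf (a, b) (tf (a', b') f), Lp.coeFn_smul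
      (Complex.exp (2 * Real.pi * Complex.I * (b * a'))) (tf (a + a', b + b') f),
    coeFn_tf (a + a', b + b') f,
    (measurePreserving_sub_right volume a).quasiMeasurePreserving.ae_eq_comp
      (coeFn_tf (a', b') f)] with x h1 h2 h3 h4
  simp only [Function.comp_apply] at h4
  rw [h1, h2, Pi.smul_apply, h3, h4]
  simp only [smul_eq_mul, ← mul_assoc, ← Complex.exp_add, sub_sub]
  congr 2
  push_cast
  ring

lemma Tr_eq_tf (a : ℝ) (f : L2) : Tr a f = tf (a, 0) f := by
  refine Lp.ext ?_
  filter_upwards [coeFn_tf (a, 0) f, coeFn_Tr a f] with x h1 h2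
  rw [h1, h2]
  simp

lemma Tr_zero (f : L2) : Tr 0 f = f := by
  refine Lp.ext ?_
  filter_upwards [coeFn_Tr 0 f] with x h2
  rw [h2, sub_zero]

lemma Tr_tf (x a b : ℝ) (f : L2) : Tr x (tf (a, b) f) = tf (x + a, b) f := by
  rw [Tr_eq_tf, tf_tf]
  simp

lemma Tr_Tr_neg (x : ℝ) (f : L2) : Tr x (Tr (-x) f) = f := by
  rw [Tr_eq_tf (-x), Tr_tf, add_neg_cancel, ← Tr_eq_tf, Tr_zero]

lemma inner_Tr_Tr (x : ℝ) (f h : L2) : ⟪Tr x f, Tr x h⟫_ℂ = ⟪f, h⟫_ℂ := by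
  rw [Tr_eq_tf, Tr_eq_tf, inner_tf_tf]

lemma continuous_Tr (f : L2) : Continuous fun x => Tr x f := by
  have h : ∀ x, Tr x f = DomAddAct.mk (-x) +ᵥ f := by
    intro x
    refine Lp.ext ?_
    filter_upwards [coeFn_Tr x f, DomAddAct.vadd_Lp_ae_eq (DomAddAct.mk (-x)) f] with y h1 h2
    rw [h1, h2]
    simp [sub_eq_neg_add]
  simp only [h]
  have : Fact ((2 : ℝ≥0∞) ≠ ∞) := ⟨by norm_num⟩
  exact (DomAddAct.continuous_mk.comp continuous_neg).vadd continuous_const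

/-- The indicator functions of subsets of `(jT, (j+1)T]`, `j ∈ ℤ`, in `L²(ℝ)`. -/
def cellIndicators (T : ℝ) : Set L2 :=
  {f | ∃ (j : ℤ) (U : Set ℝ) (hU : MeasurableSet U) (hU' : volume U ≠ ∞),
    U ⊆ Set.Ioc (j * T) (j * T + T) ∧ f = indicatorConstLp 2 hU hU' (1 : ℂ)}

lemma eq_zero_of_inner_cellIndicators {T : ℝ} (hT : 0 < T) (v : L2)
    (hv : ∀ s ∈ cellIndicators T, ⟪s, v⟫_ℂ = 0) : v = 0 := by
  have hint : ∀ s : Set ℝ, MeasurableSet s → volume s < ∞ → IntegrableOn v s volume := by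
    intro s _ hs'
    exact (integrableOn_Lp_of_measure_ne_top v (by norm_num) hs'.ne)
  refine (Lp.eq_zero_iff_ae_eq_zero).mpr (Lp.ae_eq_zero_of_forall_setIntegral_eq_zero v
    (by norm_num) (by norm_num) hint fun s hs hs' => ?_)
  let I : ℤ → Set ℝ := fun j => Set.Ioc (j * T) (j * T + T)
  have hcover : (⋃ j, s ∩ I j) = s := by
    rw [← Set.inter_iUnion]
    have := iUnion_Ioc_add_zsmul hT 0
    have h2 : (⋃ j, I j) = Set.univ := by
      rw [← this]
      refine Set.iUnion_congr fun j => ?_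
      simp only [I, zsmul_eq_mul, zero_add]
      push_cast
      ring_nf
    rw [h2, Set.inter_univ]
  have hdisj : Pairwise (Function.onFun Disjoint fun j => s ∩ I j) := by
    intro i j hij
    have h1 := Set.pairwise_disjoint_Ioc_add_zsmul 0 T hij
    refine Disjoint.mono Set.inter_subset_right Set.inter_subset_right ?_
    simp only [Function.onFun, zsmul_eq_mul, zero_add] at h1
    push_cast at h1
    simpa only [I, add_mul, one_mul] using h1
  rw [← hcover, integral_iUnion (fun j => hs.inter measurableSet_Ioc) hdisj
    (by rw [hcover]; exact hint s hs hs')]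
  refine (tsum_congr fun j => ?_).trans tsum_zero
  have hfin : volume (s ∩ I j) ≠ ∞ := ((measure_mono Set.inter_subset_left).trans_lt hs').ne
  rw [← L2.inner_indicatorConstLp_one (hs.inter measurableSet_Ioc) hfin]
  exact hv _ ⟨j, _, _, hfin, Set.inter_subset_right, rfl⟩

lemma dense_span_cellIndicators {T : ℝ} (hT : 0 < T) :
    Dense (Submodule.span ℂ (cellIndicators T) : Set L2) := by
  rw [Submodule.dense_iff_topologicalClosure_eq_top, Submodule.topologicalClosure_eq_top_iff,
    Submodule.eq_bot_iff]
  intro v hv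
  exact eq_zero_of_inner_cellIndicators hT v fun s hs =>
    (Submodule.mem_orthogonal _ _).mp hv s (Submodule.subset_span hs)

lemma integrable_conj_mul_comp_add (f h : L2) (c : ℝ) :
    Integrable fun u : ℝ => conj (f u) * h (u + c) :=
  MemLp.integrable_mul (p := 2) (q := 2) (Lp.memLp f).star
    ((Lp.memLp h).comp_measurePreserving (measurePreserving_add_right volume c))

/-- Walnut-type formula: the sum over modulations of the products of short-time Fourier coefficients
of cell indicators. -/
lemma hasSum_inner_tf_mul_inner_tf (g γ : L2) {β : ℝ} (hβ : 0 < β) {U V : Set ℝ}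
    (hU : MeasurableSet U) (hU' : volume U ≠ ∞) (hV : MeasurableSet V) (hV' : volume V ≠ ∞)
    {j j' : ℤ} (hUj : U ⊆ Set.Ioc (j * β⁻¹) (j * β⁻¹ + β⁻¹))
    (hVj : V ⊆ Set.Ioc (j' * β⁻¹) (j' * β⁻¹ + β⁻¹)) (x : ℝ) :
    HasSum (fun m : ℤ => ⟪indicatorConstLp 2 hV hV' (1 : ℂ), tf (x, β * m) g⟫_ℂ *
        ⟪tf (x, β * m) γ, indicatorConstLp 2 hU hU' (1 : ℂ)⟫_ℂ)
      ((β⁻¹ : ℝ) * ∫ y, (U ∩ (fun y => y + (j' - j : ℤ) / β) ⁻¹' V).indicator (fun _ => (1 : ℂ)) y *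
        (conj (γ (y - x)) * g (y - x + (j' - j : ℤ) / β))) := by
  set κ : ℝ := (j' - j : ℤ) / β with hκ
  set V₀ : Set ℝ := (fun y => y + κ) ⁻¹' V with hV₀
  set I : Set ℝ := Set.Ioc (j * β⁻¹) (j * β⁻¹ + β⁻¹) with hI
  have hβc : (β : ℂ) ≠ 0 := by exact_mod_cast hβ.ne'
  have hV₀m : MeasurableSet V₀ := (measurable_add_const κ) hV
  have hV₀I : V₀ ⊆ I := by
    intro y hy
    have h1 := hVj hy
    have h2 : κ = j' * β⁻¹ - j * β⁻¹ := by rw [hκ]; push_cast; ring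
    simp only [Set.mem_Ioc, h2, hI] at h1 ⊢
    constructor <;> linarith [h1.1, h1.2]
  let φ : ℝ → ℂ := U.indicator fun y => conj (γ (y - x))
  let ψ : ℝ → ℂ := V₀.indicator fun y => g (y + κ - x)
  have hφ : MemLp φ 2 (volume.restrict I) :=
    (((memLp_translate x γ).star).indicator hU).restrict I
  have hψ : MemLp ψ 2 (volume.restrict I) :=
    (((memLp_translate x g).comp_measurePreserving
      (measurePreserving_add_right volume κ)).indicator hV₀m).restrict I
  have hpars := hasSum_setIntegral_mul_setIntegral (inv_pos.mpr hβ) (j * β⁻¹) hφ hψ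
  rw [← hI] at hpars
  have hval : ∫ y in I, ψ y * φ y
      = ∫ y, (U ∩ V₀).indicator (fun _ => (1 : ℂ)) y *
        (conj (γ (y - x)) * g (y - x + κ)) := by
    rw [setIntegral_eq_integral_of_forall_compl_eq_zero]
    · refine integral_congr_ae (Eventually.of_forall fun y => ?_)
      by_cases h1 : y ∈ U <;> by_cases h2 : y ∈ V₀ <;>
        simp [φ, ψ, h1, h2, mul_comm, sub_add_eq_add_sub]
    · intro y hy
      have : y ∉ U := fun h => hy (hUj h)
      simp [φ, this]
  rw [hval] at hpars
  refine hpars.congr_fun fun m => ?_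
  have hg : ⟪indicatorConstLp 2 hV hV' (1 : ℂ), tf (x, β * m) g⟫_ℂ
      = Complex.exp (-(2 * Real.pi * Complex.I * (β * m * x))) * ∫ y in I,
        Complex.exp (2 * Real.pi * Complex.I * (m / (β⁻¹ : ℝ) * y)) * ψ y := by
    rw [L2.inner_indicatorConstLp_one, setIntegral_congr_ae hV
      ((coeFn_tf (x, β * m) g).mono fun y hy _ => hy), ← integral_indicator hV,
      ← integral_add_right_eq_self _ κ, setIntegral_eq_integral_of_forall_compl_eq_zero,
      ← integral_const_mul]
    · refine integral_congr_ae (Eventually.of_forall fun y => ?_)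
      by_cases h2 : y ∈ V₀
      · have h3 : y + κ ∈ V := h2
        simp only [ψ, Set.indicator_of_mem h2, Set.indicator_of_mem h3]
        refine Eq.trans ?_ (mul_assoc _ _ _)
        rw [← Complex.exp_add]
        congr 1
        refine Complex.exp_eq_exp_iff_exists_int.mpr ⟨m * (j' - j), ?_⟩
        rw [hκ]
        push_cast
        field_simp
        ring
      · have h3 : y + κ ∉ V := h2
        simp only [ψ, Set.indicator_of_notMem h2, Set.indicator_of_notMem h3, mul_zero]
    · intro y hy
      have : y ∉ V₀ := fun h => hy (hV₀I h)
      simp [ψ, this]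
  have hγ : ⟪tf (x, β * m) γ, indicatorConstLp 2 hU hU' (1 : ℂ)⟫_ℂ
      = Complex.exp (2 * Real.pi * Complex.I * (β * m * x)) * ∫ y in I,
        Complex.exp (-(2 * Real.pi * Complex.I * (m / (β⁻¹ : ℝ) * y))) * φ y := by
    rw [← inner_conj_symm, L2.inner_indicatorConstLp_one, setIntegral_congr_ae hU
      ((coeFn_tf (x, β * m) γ).mono fun y hy _ => hy), ← integral_indicator hU, ← integral_conj,
      setIntegral_eq_integral_of_forall_compl_eq_zero, ← integral_const_mul]
    · refine integral_congr_ae (Eventually.of_forall fun y => ?_)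
      by_cases h2 : y ∈ U
      · simp only [φ, Set.indicator_of_mem h2]
        refine Eq.trans ?_ (mul_assoc _ _ _)
        rw [map_mul, ← Complex.exp_add, ← Complex.exp_conj]
        congr 2
        simp [Complex.conj_ofNat]
        ring
      · simp only [φ, Set.indicator_of_notMem h2, mul_zero, map_zero]
    · intro y hy
      have : y ∉ U := fun h => hy (hUj h)
      simp [φ, this]
  rw [hg, hγ, mul_mul_mul_comm, ← Complex.exp_add, neg_add_cancel, Complex.exp_zero, one_mul]

/-- An operator represented by the Gabor systems of `g` and `γ` over `αℤ × βℤ` commutes with the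
translation `T_{α/ν}` whenever the adjoint-lattice coefficients vanish off `νℤ`. -/
lemma comp_Tr_of_hasSum_of_orthogonal {g γ : L2} {α β : ℝ} (hα : 0 < α) (hβ : 0 < β)
    (P : L2 →L[ℂ] L2)
    (hP : ∀ f h : L2, HasSum (fun i : ℤ × ℤ =>
      ⟪h, tf (α * i.1, β * i.2) g⟫_ℂ * ⟪tf (α * i.1, β * i.2) γ, f⟫_ℂ) ⟪h, P f⟫_ℂ)
    {ν : ℕ} (hν : 1 ≤ ν)
    (horth : ∀ k l : ℤ, ¬ ((ν : ℤ) ∣ l) →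
      ⟪g, tf ((k : ℝ) / β, (l : ℝ) / α) γ⟫_ℂ = 0) (f : L2) :
    P (Tr (α / ν) f) = Tr (α / ν) (P f) := by
  have hT : 0 < β⁻¹ := inv_pos.mpr hβ
  have hcell : ∀ f ∈ cellIndicators β⁻¹, ∀ h ∈ cellIndicators β⁻¹,
      ⟪h, P f⟫_ℂ = ⟪Tr (α / ν) h, P (Tr (α / ν) f)⟫_ℂ := by
    rintro f ⟨j, U, hU, hU', hUj, hf⟩ h ⟨j', V, hV, hV', hVj, hh⟩
    let w : ℝ → ℂ := (U ∩ (fun y => y + (j' - j : ℤ) / β) ⁻¹' V).indicator fun _ => (1 : ℂ)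
    let p : ℝ → ℂ := fun u => conj (γ u) * g (u + (j' - j : ℤ) / β)
    let a : ℝ → ℂ := fun x => (β⁻¹ : ℝ) * ∫ y, w y * p (y - x)
    have hw : Integrable w := by
      refine (integrable_indicator_iff (hU.inter ((measurable_add_const _) hV))).mpr ?_
      exact integrableOn_const ((measure_mono Set.inter_subset_left).trans_lt hU'.lt_top).ne
    have hp : Integrable p := integrable_conj_mul_comp_add γ g _
    let F : ℝ → ℂ := fun x => ⟪Tr (-x) h, P (Tr (-x) f)⟫_ℂ
    have hF : Continuous F :=
      ((continuous_Tr h).comp continuous_neg).inner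
        (P.continuous.comp ((continuous_Tr f).comp continuous_neg))
    have hsum : ∀ x, HasSum (fun n : ℤ => a (x + α * n)) (F x) := by
      intro x
      refine (hP (Tr (-x) f) (Tr (-x) h)).prod_fiberwise fun n => ?_
      have h1 := hasSum_inner_tf_mul_inner_tf g γ hβ hU hU' hV hV' hUj hVj (x + α * n)
      rw [← hf, ← hh] at h1
      refine h1.congr_fun fun m => ?_
      rw [← inner_Tr_Tr x (Tr (-x) h), ← inner_Tr_Tr x _ (Tr (-x) f), Tr_Tr_neg, Tr_Tr_neg,
        Tr_tf, Tr_tf]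
    have hcoef : ∀ l : ℤ, ¬ ((ν : ℤ) ∣ l) →
        ∫ x : ℝ, Complex.exp (2 * Real.pi * Complex.I * ((l / α : ℝ) * x)) * a x = 0 := by
      intro l hl
      have h1 : ∫ u : ℝ, Complex.exp (-(2 * Real.pi * Complex.I * ((l / α : ℝ) * u))) * p u
          = 0 := by
        have h2 := congrArg conj (horth (j' - j) l hl)
        rw [L2.inner_def, ← integral_conj, map_zero,
          ← integral_add_right_eq_self _ (((j' - j : ℤ) : ℝ) / β)] at h2
        rw [← h2]
        refine integral_congr_ae ?_
        filter_upwards [(measurePreserving_add_right volume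
          (((j' - j : ℤ) : ℝ) / β)).quasiMeasurePreserving.ae_eq_comp
            (coeFn_tf (((j' - j : ℤ) : ℝ) / β, (l : ℝ) / α) γ)] with u hu
        simp only [Function.comp_apply, add_sub_cancel_right] at hu
        rw [inner_conj_symm, RCLike.inner_apply, hu, map_mul, ← Complex.exp_conj]
        simp only [p, map_mul, map_ofNat, Complex.conj_ofReal, Complex.conj_I]
        rw [mul_neg, neg_mul]
        ring
      have h3 : ∀ x : ℝ, Complex.exp (2 * Real.pi * Complex.I * ((l / α : ℝ) * x)) * a x
          = (β⁻¹ : ℝ) * (Complex.exp (2 * Real.pi * Complex.I * ((l / α : ℝ) * x)) *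
            ∫ y, w y * p (y - x)) := fun x => mul_left_comm _ _ _
      simp only [h3]
      rw [integral_const_mul, integral_exp_mul_integral_mul_comp_sub hw hp, h1, mul_zero, mul_zero]
    have hper := periodic_of_hasSum_comp_add_mul_int
      ((integrable_integral_mul_comp_sub hw hp).const_mul _) hF hα hν hsum hcoef (-(α / ν))
    simpa only [F, neg_add_cancel, neg_zero, neg_neg, Tr_zero] using hper
  let τ : ℝ → L2 →L[ℂ] L2 := fun s => (tfIsometry (s, 0)).toContinuousLinearMap
  have hτ : ∀ s f, τ s f = Tr s f := fun s f => (Tr_eq_tf s f).symm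
  have hext : τ (-(α / ν)) ∘L P ∘L τ (α / ν) = P := by
    refine ContinuousLinearMap.ext_on (dense_span_cellIndicators hT) fun f hf => ?_
    refine sub_eq_zero.mp (eq_zero_of_inner_cellIndicators hT _ fun h hh => ?_)
    rw [inner_sub_right, sub_eq_zero, hcell f hf h hh]
    simp only [ContinuousLinearMap.comp_apply, hτ]
    rw [← inner_Tr_Tr (α / ν) h, Tr_Tr_neg]
  have hf := congrArg (Tr (α / ν)) (DFunLike.congr_fun hext f)
  simpa only [ContinuousLinearMap.comp_apply, hτ, Tr_Tr_neg] using hf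

/-- The indexing of `αℤ × βℤ` by `ℤ × ℤ`. -/
def sepLatticeEquiv {α β : ℝ} (hα : α ≠ 0) (hβ : β ≠ 0) : ℤ × ℤ ≃ sepLattice α β :=
  Equiv.ofBijective (fun i => ⟨(α * i.1, β * i.2), i.1, i.2, rfl⟩) (by
    constructor
    · rintro ⟨n, m⟩ ⟨n', m'⟩ h
      simpa [hα, hβ] using congrArg Subtype.val h
    · rintro ⟨_, n, m, rfl⟩
      exact ⟨(n, m), rfl⟩)

/-- The span of a Gabor system over `αℤ × βℤ` is invariant under the shifts from that lattice. -/
lemma tf_mem_gaborSpan {g f : L2} {α β : ℝ} (hf : f ∈ gaborSpan g (sepLattice α β)) (n m : ℤ) :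
    tf (α * n, β * m) f ∈ gaborSpan g (sepLattice α β) := by
  refine map_mem_closure (tfIsometry (α * n, β * m)).continuous hf fun x hx => ?_
  have hmap : Submodule.span ℂ ((fun z => tf z g) '' sepLattice α β) ≤
      (Submodule.span ℂ ((fun z => tf z g) '' sepLattice α β)).comap
        (tfIsometry (α * n, β * m)).toLinearMap := by
    rw [Submodule.span_le]
    rintro _ ⟨_, ⟨n', m', rfl⟩, rfl⟩
    simp only [Submodule.comap_coe, Set.mem_preimage, LinearIsometry.coe_toLinearMap,
      tfIsometry_apply, tf_tf, SetLike.mem_coe]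
    refine Submodule.smul_mem _ _ (Submodule.subset_span ⟨_, ⟨n + n', m + m', ?_⟩, rfl⟩)
    push_cast
    ring_nf
  exact hmap hx

/-- The frame operator commutes with the shifts from the lattice. -/
lemma hasSum_inner_tf_smul_tf {g γ : L2} {α β : ℝ}
    (h : HasSum (fun i : ℤ × ℤ =>
      ⟪tf (α * i.1, β * i.2) g, γ⟫_ℂ • tf (α * i.1, β * i.2) g) g) (n m : ℤ) :
    HasSum (fun i : ℤ × ℤ =>
      ⟪tf (α * i.1, β * i.2) g, tf (α * n, β * m) γ⟫_ℂ • tf (α * i.1, β * i.2) g)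
      (tf (α * n, β * m) g) := by
  rw [← (Equiv.addLeft ((n, m) : ℤ × ℤ)).hasSum_iff]
  have h1 := h.mapL (tfIsometry (α * n, β * m)).toContinuousLinearMap
  refine h1.congr_fun fun i => ?_
  simp only [Function.comp_apply, Equiv.coe_addLeft, Prod.fst_add, Prod.snd_add, map_smul,
    LinearIsometry.coe_toContinuousLinearMap, tfIsometry_apply]
  rw [← inner_tf_tf (α * n, β * m) (tf (α * i.1, β * i.2) g) γ, tf_tf, inner_smul_left, smul_smul]
  have hphase := norm_exp_two_pi_I_mul (β * m) (α * i.1)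
  set c := Complex.exp (2 * Real.pi * Complex.I * ((β * m : ℝ) * (α * i.1 : ℝ))) with hc
  have hcc : conj c * c = 1 := by
    rw [Complex.conj_mul', hphase]; simp
  rw [mul_right_comm, hcc, one_mul]
  push_cast
  simp only [mul_add]

/-- (iv) ⇒ (i) of Theorem 4.4: if `⟨T_{k/β} M_{ℓ/α} γ, g⟩ = 0`
for all `k ∈ ℤ`, `ℓ ∈ ℤ \ νℤ`, then `T_{α/ν} g ∈ 𝒢`. -/
theorem statement_15 (g : L2) (hg : InS0 g) (α β : ℝ) (hα : 0 < α) (hβ : 0 < β)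
    (hframe : IsFrameSeq g (sepLattice α β)) (γ : L2) (hγ : IsDualWindow g γ α β)
    (ν : ℕ) (hν : 1 ≤ ν)
    (horth : ∀ k l : ℤ, ¬ ((ν : ℤ) ∣ l) →
      ⟪g, tf ((k : ℝ) / β, (l : ℝ) / α) γ⟫_ℂ = 0) :
    Tr (α / ν) g ∈ gaborSpan g (sepLattice α β) := by
  obtain ⟨A, B, hA, -, hAB⟩ := hframe
  obtain ⟨hγmem, hγsum⟩ := hγ
  let E := sepLatticeEquiv hα.ne' hβ.ne'
  let K := (Submodule.span ℂ ((fun z => tf z g) '' sepLattice α β)).topologicalClosure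
  have hK : ∀ f : L2, f ∈ gaborSpan g (sepLattice α β) ↔ f ∈ K := fun f => Iff.rfl
  have : CompleteSpace K :=
    (Submodule.isClosed_topologicalClosure _).completeSpace_coe
  have hgen : ∀ n m : ℤ, tf (α * n, β * m) g ∈ K := fun n m =>
    Submodule.le_topologicalClosure _ (Submodule.subset_span ⟨_, ⟨n, m, rfl⟩, rfl⟩)
  have hg : g ∈ K := by
    have h0 := hgen 0 0
    rwa [Int.cast_zero, mul_zero, mul_zero, ← Tr_eq_tf, Tr_zero] at h0
  have hre : ∀ f : L2, ∑' lam : sepLattice α β, ‖⟪tf (lam : ℝ × ℝ) g, f⟫_ℂ‖ ^ 2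
      = ∑' i : ℤ × ℤ, ‖⟪tf (α * i.1, β * i.2) g, f⟫_ℂ‖ ^ 2 := fun f =>
    (E.tsum_eq fun lam : sepLattice α β => ‖⟪tf (lam : ℝ × ℝ) g, f⟫_ℂ‖ ^ 2).symm
  simp only [hre] at hAB
  have hγsum' : HasSum (fun i : ℤ × ℤ =>
      ⟪tf (α * i.1, β * i.2) g, γ⟫_ℂ • tf (α * i.1, β * i.2) g) g := E.hasSum_iff.mpr hγsum
  have hP := hasSum_inner_mul_inner_starProjection
    (fun i : ℤ × ℤ => tf (α * i.1, β * i.2) g) (fun i : ℤ × ℤ => tf (α * i.1, β * i.2) γ) K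
    (fun i => hgen i.1 i.2) (fun i => tf_mem_gaborSpan hγmem i.1 i.2) hA
    (fun f hf => (hAB f hf).1) (fun f hf => (hAB f hf).2)
    (fun i => hasSum_inner_tf_smul_tf hγsum' i.1 i.2)
  have hcomm := comp_Tr_of_hasSum_of_orthogonal hα hβ K.starProjection hP hν horth g
  rw [Submodule.starProjection_eq_self_iff.mpr hg] at hcomm
  exact (hK _).mpr (Submodule.starProjection_eq_self_iff.mp hcomm)

end
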